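/- arXiv:1104.3663 — 2 statements merged into one kernel-verified Lean document; each statement's English description precedes it below -/
import Mathlib

section
/- Let h : ℝ → ℝ be 2π-periodic, Lipschitz, with min h > 0, satisfying h'' + h ≥ 0 in the distributional sense, and symmetric, i.e., h(θ + π) = h(θ) for all θ. For v a C^∞ function compactly supported in (0, π), let ṽ be the π-periodic function on ℝ agreeing with v on (0, π) (and vanishing at multiples of π). Then, with C = C(h) > 0 the constant from the concavity estimate for non-symmetric perturbations, the quadratic form Q(ṽ) := B(h)·∫₀^{2π}(ṽ² − ṽ'²) dθ − 2·(∫₀^{2π}(h ṽ − h' ṽ') dθ)·(∫₀^{2π} ṽ/h³ dθ) + 3·A(h)·∫₀^{2π} ṽ²/h⁴ dθ satisfies Q(ṽ) ≤ 4C·‖v‖_{L^∞}·‖v‖_{L¹} − 2·B(h)·∫₀^{π} v'² dθ. -/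
open MeasureTheory Real Set intervalIntegral

noncomputable section

/-- `h'' + h ≥ 0` in the distributional sense on the circle: testing against every
nonnegative `2π`-periodic smooth function gives a nonnegative number. -/
def DistribConvexCirc (h : ℝ → ℝ) : Prop :=
  ∀ φ : ℝ → ℝ, ContDiff ℝ (⊤ : ℕ∞) φ → Function.Periodic φ (2 * π) → (∀ θ, 0 ≤ φ θ) →
    0 ≤ ∫ θ in (0:ℝ)..(2 * π), h θ * (deriv (deriv φ) θ + φ θ)

/-- `A(h) = (1/2)∫₀^{2π} (h² − h'²)`. -/
def Afun (h : ℝ → ℝ) : ℝ :=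
  (1 / 2) * ∫ θ in (0:ℝ)..(2 * π), ((h θ) ^ 2 - (deriv h θ) ^ 2)

/-- `B(h) = (1/2)∫₀^{2π} h⁻²`. -/
def Bfun (h : ℝ → ℝ) : ℝ :=
  (1 / 2) * ∫ θ in (0:ℝ)..(2 * π), ((h θ) ^ 2)⁻¹

/-- The second derivative at `t = 0` of `t ↦ A(h+tv)·B(h+tv)`:
`Q(v) = B(h)∫(v² − v'²) − 2(∫(hv − h'v'))(∫ v/h³) + 3A(h)∫ v²/h⁴`. -/
def Qform (h v : ℝ → ℝ) : ℝ :=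
  Bfun h * (∫ θ in (0:ℝ)..(2 * π), ((v θ) ^ 2 - (deriv v θ) ^ 2))
    - 2 * (∫ θ in (0:ℝ)..(2 * π), (h θ * v θ - deriv h θ * deriv v θ))
        * (∫ θ in (0:ℝ)..(2 * π), v θ / (h θ) ^ 3)
    + 3 * Afun h * ∫ θ in (0:ℝ)..(2 * π), (v θ) ^ 2 / (h θ) ^ 4

/-- The `L^∞`-norm of a `2π`-periodic continuous function. -/
def supNorm (v : ℝ → ℝ) : ℝ := sSup ((fun θ => |v θ|) '' Set.Icc (0:ℝ) (2 * π))

/-- The `L¹`-norm over one period. -/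
def l1Norm (v : ℝ → ℝ) : ℝ := ∫ θ in (0:ℝ)..(2 * π), |v θ|

theorem abs_le_supNorm {w : ℝ → ℝ} (hw : Continuous w) {θ : ℝ}
    (hθ : θ ∈ Set.Icc (0:ℝ) (2 * π)) : |w θ| ≤ supNorm w :=
  le_csSup (isCompact_Icc.bddAbove_image hw.abs.continuousOn) ⟨θ, hθ, rfl⟩

theorem supNorm_nonneg (w : ℝ → ℝ) : 0 ≤ supNorm w :=
  Real.sSup_nonneg (by rintro _ ⟨θ, -, rfl⟩; exact abs_nonneg _)

theorem abs_le_supNorm_of_periodic {w : ℝ → ℝ} (hw : Continuous w)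
    (hper : Function.Periodic w (2 * π)) (θ : ℝ) : |w θ| ≤ supNorm w := by
  obtain ⟨y, hy, hyw⟩ := hper.exists_mem_Ico₀ two_pi_pos θ
  rw [hyw]
  exact abs_le_supNorm hw (Ico_subset_Icc_self hy)

theorem l1Norm_nonneg (w : ℝ → ℝ) : 0 ≤ l1Norm w :=
  integral_nonneg two_pi_pos.le fun _ _ => abs_nonneg _

/-- Integration by parts of a Lipschitz periodic function against a smooth periodic one. -/
theorem integral_mul_sub_deriv_mul_deriv {h w : ℝ → ℝ} (hper : Function.Periodic h (2 * π))
    (hlip : ∃ L, LipschitzWith L h) (hw : ContDiff ℝ (⊤ : ℕ∞) w)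
    (hwper : Function.Periodic w (2 * π)) :
    ∫ θ in (0:ℝ)..(2 * π), (h θ * w θ - deriv h θ * deriv w θ)
      = ∫ θ in (0:ℝ)..(2 * π), h θ * (deriv (deriv w) θ + w θ) := by
  obtain ⟨L, hL⟩ := hlip
  have hac : AbsolutelyContinuousOnInterval h 0 (2 * π) :=
    (hL.lipschitzOnWith (s := uIcc 0 (2 * π))).absolutelyContinuousOnInterval
  have hw' : ContDiff ℝ (⊤ : ℕ∞) (deriv w) := (contDiff_infty_iff_deriv.mp hw).2
  have hw'' : ContDiff ℝ (⊤ : ℕ∞) (deriv (deriv w)) := (contDiff_infty_iff_deriv.mp hw').2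
  have hac' : AbsolutelyContinuousOnInterval (deriv w) 0 (2 * π) :=
    (hw'.of_le (by simp)).contDiffOn.absolutelyContinuousOnInterval
  have hdper : deriv w (2 * π) = deriv w 0 := by
    have h1 := deriv_comp_add_const (f := w) (2 * π) 0
    rw [funext hwper, zero_add] at h1
    exact h1.symm
  have hparts := hac.integral_mul_deriv_eq_deriv_mul hac'
  have hh0 : h (2 * π) = h 0 := by simpa using hper 0
  rw [hdper, hh0, sub_self, zero_sub] at hparts
  have hcont := hL.continuous
  simp only [mul_add]
  rw [integral_sub (f := fun θ => h θ * w θ)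
      ((hcont.mul hw.continuous).intervalIntegrable _ _)
      (hac.intervalIntegrable_deriv.mul_continuousOn hw'.continuous.continuousOn),
    integral_add (f := fun θ => h θ * deriv (deriv w) θ) (g := fun θ => h θ * w θ)
      ((hcont.mul hw''.continuous).intervalIntegrable _ _)
      ((hcont.mul hw.continuous).intervalIntegrable _ _), hparts]
  ring

/-- The measure `h'' + h` has total mass `∫ h`, so it is bounded as a functional for the
supremum norm. -/
theorem abs_integral_mul_deriv_deriv_add_le {h w : ℝ → ℝ} (hh : Continuous h)
    (hconv : DistribConvexCirc h) (hw : ContDiff ℝ (⊤ : ℕ∞) w)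
    (hwper : Function.Periodic w (2 * π)) :
    |∫ θ in (0:ℝ)..(2 * π), h θ * (deriv (deriv w) θ + w θ)|
      ≤ supNorm w * ∫ θ in (0:ℝ)..(2 * π), h θ := by
  have hw' : ContDiff ℝ (⊤ : ℕ∞) (deriv w) := (contDiff_infty_iff_deriv.mp hw).2
  have hw'' : ContDiff ℝ (⊤ : ℕ∞) (deriv (deriv w)) := (contDiff_infty_iff_deriv.mp hw').2
  have hbound := abs_le_supNorm_of_periodic hw.continuous hwper
  have hi1 : IntervalIntegrable (fun θ => supNorm w * h θ) volume 0 (2 * π) :=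
    (continuous_const.mul hh).intervalIntegrable _ _
  have hi2 : IntervalIntegrable (fun θ => h θ * (deriv (deriv w) θ + w θ)) volume 0 (2 * π) :=
    (hh.mul (hw''.continuous.add hw.continuous)).intervalIntegrable _ _
  have hplus := hconv (fun θ => supNorm w + w θ) (contDiff_const.add hw)
    (fun θ => by simp only [hwper θ]) (fun θ => by linarith [(abs_le.mp (hbound θ)).1])
  have hminus := hconv (fun θ => supNorm w - w θ) (contDiff_const.sub hw)
    (fun θ => by simp only [hwper θ]) (fun θ => by linarith [(abs_le.mp (hbound θ)).2])
  have hd1 : deriv (fun θ => supNorm w + w θ) = deriv w := by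
    ext θ; simp
  have hd2 : deriv (fun θ => supNorm w - w θ) = fun θ => -deriv w θ := by
    ext θ; simp
  have e1 : ∫ θ in (0:ℝ)..(2 * π), h θ * (deriv (deriv w) θ + (supNorm w + w θ))
      = supNorm w * (∫ θ in (0:ℝ)..(2 * π), h θ)
        + ∫ θ in (0:ℝ)..(2 * π), h θ * (deriv (deriv w) θ + w θ) := by
    rw [← intervalIntegral.integral_const_mul, ← integral_add hi1 hi2]
    exact integral_congr fun θ _ => by ring
  have e2 : ∫ θ in (0:ℝ)..(2 * π), h θ * (-deriv (deriv w) θ + (supNorm w - w θ))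
      = supNorm w * (∫ θ in (0:ℝ)..(2 * π), h θ)
        - ∫ θ in (0:ℝ)..(2 * π), h θ * (deriv (deriv w) θ + w θ) := by
    rw [← intervalIntegral.integral_const_mul, ← integral_sub hi1 hi2]
    exact integral_congr fun θ _ => by ring
  simp only [hd1] at hplus
  simp only [hd2, deriv.fun_neg] at hminus
  rw [e1] at hplus
  rw [e2] at hminus
  exact abs_le.mpr ⟨by linarith, by linarith⟩

theorem integral_sq_le_supNorm_mul_l1Norm {w : ℝ → ℝ} (hw : Continuous w) :
    ∫ θ in (0:ℝ)..(2 * π), (w θ) ^ 2 ≤ supNorm w * l1Norm w := by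
  rw [l1Norm, ← intervalIntegral.integral_const_mul]
  refine integral_mono_on two_pi_pos.le ((hw.pow 2).intervalIntegrable _ _)
    ((continuous_const.mul hw.abs).intervalIntegrable _ _) fun θ hθ => ?_
  rw [← sq_abs, sq]
  exact mul_le_mul_of_nonneg_right (abs_le_supNorm hw hθ) (abs_nonneg _)

theorem abs_integral_div_pow_le {h f : ℝ → ℝ} (hh : Continuous h) (hf : Continuous f) {m : ℝ}
    (hm : 0 < m) (hmh : ∀ θ, m ≤ h θ) (k : ℕ) :
    |∫ θ in (0:ℝ)..(2 * π), f θ / (h θ) ^ k|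
      ≤ (∫ θ in (0:ℝ)..(2 * π), |f θ|) / m ^ k := by
  have hne : ∀ θ, (h θ) ^ k ≠ 0 := fun θ => (pow_pos (hm.trans_le (hmh θ)) k).ne'
  refine (abs_integral_le_integral_abs two_pi_pos.le).trans ?_
  rw [← intervalIntegral.integral_div]
  refine integral_mono_on two_pi_pos.le
    ((hf.div (hh.pow k) hne).abs.intervalIntegrable _ _)
    ((hf.abs.div_const _).intervalIntegrable _ _) fun θ _ => ?_
  rw [abs_div, abs_of_pos (pow_pos (hm.trans_le (hmh θ)) k)]
  have := hmh θ
  gcongr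

/-- The concavity estimate for arbitrary smooth periodic perturbations. -/
theorem exists_Qform_le {h : ℝ → ℝ} (hper : Function.Periodic h (2 * π))
    (hlip : ∃ L, LipschitzWith L h) (hpos : ∀ θ, 0 < h θ) (hconv : DistribConvexCirc h) :
    ∃ C > 0, ∀ w : ℝ → ℝ, ContDiff ℝ (⊤ : ℕ∞) w → Function.Periodic w (2 * π) →
      Qform h w ≤ C * supNorm w * l1Norm w
        - Bfun h * ∫ θ in (0:ℝ)..(2 * π), (deriv w θ) ^ 2 := by
  have hh : Continuous h := hlip.choose_spec.continuous
  obtain ⟨x₀, -, hx₀⟩ := isCompact_Icc.exists_isMinOn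
    (nonempty_Icc.mpr two_pi_pos.le) hh.continuousOn
  have hmh : ∀ θ, h x₀ ≤ h θ := fun θ => by
    obtain ⟨y, hy, hyh⟩ := hper.exists_mem_Ico₀ two_pi_pos θ
    rw [hyh]
    exact hx₀ (Ico_subset_Icc_self hy)
  have hm := hpos x₀
  set m := h x₀
  have hB : 0 ≤ Bfun h :=
    mul_nonneg (by norm_num) (integral_nonneg two_pi_pos.le fun θ _ => by positivity)
  have hI : 0 ≤ ∫ θ in (0:ℝ)..(2 * π), h θ :=
    integral_nonneg two_pi_pos.le fun θ _ => (hpos θ).le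
  set I := ∫ θ in (0:ℝ)..(2 * π), h θ
  refine ⟨Bfun h + 2 * I / m ^ 3 + 3 * |Afun h| / m ^ 4 + 1, by positivity, fun w hw hwper => ?_⟩
  have hwc := hw.continuous
  have hw'c : Continuous (deriv w) := (contDiff_infty_iff_deriv.mp hw).2.continuous
  have hsq := integral_sq_le_supNorm_mul_l1Norm hwc
  have hS := supNorm_nonneg w
  have hN := l1Norm_nonneg w
  have hfst := abs_integral_mul_deriv_deriv_add_le hh hconv hw hwper
  rw [← integral_mul_sub_deriv_mul_deriv hper hlip hw hwper] at hfst
  have hsnd : |∫ θ in (0:ℝ)..(2 * π), w θ / (h θ) ^ 3| ≤ l1Norm w / m ^ 3 :=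
    abs_integral_div_pow_le hh hwc hm hmh 3
  have hthd := abs_integral_div_pow_le hh (f := fun θ => (w θ) ^ 2) (hwc.pow 2) hm hmh 4
  simp only [abs_pow, sq_abs] at hthd
  have hthd' : |∫ θ in (0:ℝ)..(2 * π), (w θ) ^ 2 / (h θ) ^ 4| ≤ supNorm w * l1Norm w / m ^ 4 :=
    hthd.trans (by gcongr)
  rw [Qform, integral_sub (f := fun θ => (w θ) ^ 2) (g := fun θ => (deriv w θ) ^ 2)
    ((hwc.pow 2).intervalIntegrable _ _) ((hw'c.pow 2).intervalIntegrable _ _)]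
  set X := ∫ θ in (0:ℝ)..(2 * π), (h θ * w θ - deriv h θ * deriv w θ)
  set Y := ∫ θ in (0:ℝ)..(2 * π), w θ / (h θ) ^ 3
  set Z := ∫ θ in (0:ℝ)..(2 * π), (w θ) ^ 2 / (h θ) ^ 4
  have hXY : -(X * Y) ≤ supNorm w * I * (l1Norm w / m ^ 3) :=
    (neg_le_abs _).trans ((abs_mul X Y).le.trans
      (mul_le_mul hfst hsnd (abs_nonneg _) (by positivity)))
  have hAZ : Afun h * Z ≤ |Afun h| * (supNorm w * l1Norm w / m ^ 4) :=
    (le_abs_self _).trans ((abs_mul _ _).le.trans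
      (mul_le_mul_of_nonneg_left hthd' (abs_nonneg _)))
  have hBsq := mul_le_mul_of_nonneg_left hsq hB
  have hSN := mul_nonneg hS hN
  have hexp : (Bfun h + 2 * I / m ^ 3 + 3 * |Afun h| / m ^ 4 + 1) * supNorm w * l1Norm w
      = Bfun h * (supNorm w * l1Norm w) + 2 * (supNorm w * I * (l1Norm w / m ^ 3))
        + 3 * (|Afun h| * (supNorm w * l1Norm w / m ^ 4)) + supNorm w * l1Norm w := by
    ring
  rw [hexp]
  linarith

section PeriodicExtension

variable {v tv : ℝ → ℝ}

theorem eq_add_shift_of_periodic_extension (hsupp : tsupport v ⊆ Set.Ioo (0:ℝ) π)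
    (hper : Function.Periodic tv π) (heq : ∀ θ ∈ Set.Ioo (0:ℝ) π, tv θ = v θ) (h0 : tv 0 = 0)
    {θ : ℝ} (hθ : θ ∈ Set.Ioo (-π) π) : tv θ = v θ + v (θ + π) := by
  have hv : ∀ x, x ∉ Set.Ioo (0:ℝ) π → v x = 0 := fun x hx =>
    image_eq_zero_of_notMem_tsupport fun hx' => hx (hsupp hx')
  rcases lt_trichotomy θ 0 with hneg | rfl | hpos
  · rw [← hper θ, heq _ ⟨by linarith [hθ.1], by linarith⟩, hv θ fun h => h.1.not_gt hneg, zero_add]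
  · rw [h0, hv 0 (by simp), hv (0 + π) (by simp), add_zero]
  · rw [heq θ ⟨hpos, hθ.2⟩, hv (θ + π) fun h => by linarith [h.2], add_zero]

theorem contDiff_periodic_extension (hv : ContDiff ℝ (⊤ : ℕ∞) v)
    (hsupp : tsupport v ⊆ Set.Ioo (0:ℝ) π) (hper : Function.Periodic tv π)
    (heq : ∀ θ ∈ Set.Ioo (0:ℝ) π, tv θ = v θ) (h0 : tv 0 = 0) :
    ContDiff ℝ (⊤ : ℕ∞) tv := by
  have hlocal : ∀ θ ∈ Set.Ioo (-π) π, ContDiffAt ℝ (⊤ : ℕ∞) tv θ := fun θ hθ => by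
    have hsum : ContDiff ℝ (⊤ : ℕ∞) fun x => v x + v (x + π) :=
      hv.add (hv.comp (contDiff_id.add contDiff_const))
    refine hsum.contDiffAt.congr_of_eventuallyEq ?_
    filter_upwards [isOpen_Ioo.mem_nhds hθ] with x hx
    exact eq_add_shift_of_periodic_extension hsupp hper heq h0 hx
  refine contDiff_iff_contDiffAt.mpr fun θ => ?_
  obtain ⟨n, hn, -⟩ := existsUnique_sub_zsmul_mem_Ico pi_pos θ 0
  rw [zero_add] at hn
  have hshift : tv = tv ∘ fun x => x - n • π := funext fun x => (hper.sub_zsmul_eq n).symm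
  rw [hshift]
  exact (hlocal _ ⟨by linarith [hn.1, pi_pos], hn.2⟩).comp θ
    (contDiff_id.sub contDiff_const).contDiffAt

theorem supNorm_periodic_extension_le (hv : Continuous v) (hper : Function.Periodic tv π)
    (heq : ∀ θ ∈ Set.Ioo (0:ℝ) π, tv θ = v θ) (h0 : tv 0 = 0) :
    supNorm tv ≤ supNorm v := by
  refine Real.sSup_le ?_ (supNorm_nonneg v)
  rintro _ ⟨θ, -, rfl⟩
  obtain ⟨y, hy, hyv⟩ := hper.exists_mem_Ico₀ pi_pos θ
  simp only [hyv]
  rcases hy.1.eq_or_lt with rfl | hpos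
  · simpa [h0] using supNorm_nonneg v
  · rw [heq y ⟨hpos, hy.2⟩]
    exact abs_le_supNorm hv ⟨hy.1, by linarith [hy.2, pi_pos]⟩

theorem integral_zero_two_pi_of_periodic_pi {f : ℝ → ℝ} (hf : Continuous f)
    (hper : Function.Periodic f π) :
    ∫ θ in (0:ℝ)..(2 * π), f θ = 2 * ∫ θ in (0:ℝ)..π, f θ := by
  have hint := hper.intervalIntegral_add_zsmul_eq 2 0 fun _ _ => hf.intervalIntegrable _ _
  simpa using hint

theorem integral_congr_Ioo_zero_pi {f g : ℝ → ℝ} (hfg : ∀ θ ∈ Set.Ioo (0:ℝ) π, f θ = g θ) :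
    ∫ θ in (0:ℝ)..π, f θ = ∫ θ in (0:ℝ)..π, g θ := by
  rw [integral_of_le pi_pos.le, integral_of_le pi_pos.le, integral_Ioc_eq_integral_Ioo,
    integral_Ioc_eq_integral_Ioo]
  exact setIntegral_congr_fun measurableSet_Ioo hfg

theorem l1Norm_periodic_extension_le (hv : Continuous v) (htv : Continuous tv)
    (hper : Function.Periodic tv π) (heq : ∀ θ ∈ Set.Ioo (0:ℝ) π, tv θ = v θ) :
    l1Norm tv ≤ 2 * l1Norm v := by
  rw [l1Norm, integral_zero_two_pi_of_periodic_pi htv.abs fun θ => by simp only [hper θ],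
    integral_congr_Ioo_zero_pi (g := fun θ => |v θ|) fun θ hθ => by simp only [heq θ hθ]]
  refine mul_le_mul_of_nonneg_left ?_ zero_le_two
  exact integral_mono_interval le_rfl pi_pos.le (by linarith [pi_pos])
    (Filter.Eventually.of_forall fun θ => abs_nonneg _) (hv.abs.intervalIntegrable _ _)

theorem integral_deriv_sq_periodic_extension (htv : ContDiff ℝ (⊤ : ℕ∞) tv)
    (hper : Function.Periodic tv π) (heq : ∀ θ ∈ Set.Ioo (0:ℝ) π, tv θ = v θ) :
    ∫ θ in (0:ℝ)..(2 * π), (deriv tv θ) ^ 2 = 2 * ∫ θ in (0:ℝ)..π, (deriv v θ) ^ 2 := by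
  have hdper : Function.Periodic (deriv tv) π := fun θ => by
    rw [← deriv_comp_add_const, funext hper]
  have hdc : Continuous (deriv tv) := (contDiff_infty_iff_deriv.mp htv).2.continuous
  rw [integral_zero_two_pi_of_periodic_pi (f := fun θ => (deriv tv θ) ^ 2) (hdc.pow 2)
      fun θ => by simp only [hdper θ],
    integral_congr_Ioo_zero_pi fun θ hθ => ?_]
  have hev : tv =ᶠ[nhds θ] v := by
    filter_upwards [isOpen_Ioo.mem_nhds hθ] with x hx using heq x hx
  rw [hev.deriv_eq]

end PeriodicExtension

/-- Concavity estimate for symmetrized perturbations: if `h` is moreover symmetric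
(`h(θ+π) = h(θ)`), then with the same constant `C = C(h) > 0` as in the concavity
estimate for non-symmetric perturbations, for every smooth `v` compactly supported in
`(0, π)` and `ṽ` the `π`-periodic function agreeing with `v` on `(0,π)` and vanishing
at multiples of `π`, one has `Q(ṽ) ≤ 4C‖v‖_∞‖v‖₁ − 2B(h)∫₀^π v'²`. -/
theorem second_derivative_concavity_symmetric
    (h : ℝ → ℝ) (hper : Function.Periodic h (2 * π)) (hlip : ∃ L, LipschitzWith L h)
    (hpos : ∀ θ, 0 < h θ) (hconv : DistribConvexCirc h)
    (hsym : ∀ θ, h (θ + π) = h θ) :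
    ∃ C > 0,
      (∀ w : ℝ → ℝ, ContDiff ℝ (⊤ : ℕ∞) w → Function.Periodic w (2 * π) →
        Qform h w ≤ C * supNorm w * l1Norm w
          - Bfun h * ∫ θ in (0:ℝ)..(2 * π), (deriv w θ) ^ 2) ∧
      (∀ v tv : ℝ → ℝ, ContDiff ℝ (⊤ : ℕ∞) v → tsupport v ⊆ Set.Ioo (0:ℝ) π →
        (∀ θ, tv (θ + π) = tv θ) → (∀ θ ∈ Set.Ioo (0:ℝ) π, tv θ = v θ) → tv 0 = 0 →
        Qform h tv ≤ 4 * C * supNorm v * l1Norm v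
          - 2 * Bfun h * ∫ θ in (0:ℝ)..π, (deriv v θ) ^ 2) := by
  obtain ⟨C, hC, hQ⟩ := exists_Qform_le hper hlip hpos hconv
  refine ⟨C, hC, hQ, fun v tv hv hsupp htper heq h0 => ?_⟩
  have htv := contDiff_periodic_extension hv hsupp htper heq h0
  have hQtv := hQ tv htv (by simpa using Function.Periodic.nat_mul htper 2)
  rw [integral_deriv_sq_periodic_extension htv htper heq] at hQtv
  have hS := supNorm_periodic_extension_le hv.continuous htper heq h0
  have hN := l1Norm_periodic_extension_le hv.continuous htv.continuous htper heq
  have hSN : supNorm tv * l1Norm tv ≤ supNorm v * (2 * l1Norm v) :=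
    mul_le_mul hS hN (l1Norm_nonneg _) (supNorm_nonneg _)
  have hCSN := mul_le_mul_of_nonneg_left hSN hC.le
  have hnonneg := mul_nonneg hC.le (mul_nonneg (supNorm_nonneg v) (l1Norm_nonneg v))
  linarith
end
end

section
/- Let (h_n) and h_∞ be 2π-periodic Lipschitz functions on ℝ satisfying h_n'' + h_n ≥ 0 and h_∞'' + h_∞ ≥ 0 in the distributional sense. If h_n → h_∞ uniformly on ℝ, then h_n → h_∞ in the H¹ sense, i.e., ∫₀^{2π}((h_n − h_∞)² + (h_n' − h_∞')²) dθ → 0 as n → ∞. In particular, convergence of convex bodies in the Hausdorff distance implies H¹ convergence of their support functions. -/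
open MeasureTheory Real Set Filter

noncomputable section

open scoped Convolution Topology NNReal

/-- The mollification `ρ ⋆ φ` of a real function by a normed bump function. -/
def mollify (ρ : ContDiffBump (0 : ℝ)) (φ : ℝ → ℝ) : ℝ → ℝ :=
  ρ.normed volume ⋆[ContinuousLinearMap.lsmul ℝ ℝ, volume] φ

theorem mollify_apply (ρ : ContDiffBump (0 : ℝ)) (φ : ℝ → ℝ) (x : ℝ) :
    mollify ρ φ x = ∫ t, ρ.normed volume t * φ (x - t) := rfl

theorem contDiff_mollify (ρ : ContDiffBump (0 : ℝ)) {φ : ℝ → ℝ} (hφ : Continuous φ) :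
    ContDiff ℝ (⊤ : ℕ∞) (mollify ρ φ) :=
  ρ.hasCompactSupport_normed.contDiff_convolution_left _ ρ.contDiff_normed
    hφ.locallyIntegrable

theorem periodic_mollify (ρ : ContDiffBump (0 : ℝ)) {φ : ℝ → ℝ} {T : ℝ}
    (hφ : Function.Periodic φ T) : Function.Periodic (mollify ρ φ) T := by
  intro x
  simp only [mollify_apply, add_sub_right_comm, hφ _]

theorem mollify_nonneg (ρ : ContDiffBump (0 : ℝ)) {φ : ℝ → ℝ} (hφ : ∀ x, 0 ≤ φ x) (x : ℝ) :
    0 ≤ mollify ρ φ x :=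
  integral_nonneg fun t => mul_nonneg (ρ.nonneg_normed t) (hφ (x - t))

theorem deriv_mollify (ρ : ContDiffBump (0 : ℝ)) {φ : ℝ → ℝ} {L : ℝ≥0}
    (hφ : LipschitzWith L φ) : deriv (mollify ρ φ) = mollify ρ (deriv φ) := by
  ext x
  have hcont : ∀ y, Continuous fun t => ρ.normed volume t * φ (y - t) := fun y =>
    ρ.continuous_normed.mul (hφ.continuous.comp (continuous_const.sub continuous_id))
  refine (hasDerivAt_integral_of_dominated_loc_of_lip (μ := volume)
    (F := fun y t => ρ.normed volume t * φ (y - t))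
    (F' := fun t => ρ.normed volume t * deriv φ (x - t))
    (bound := fun t => ρ.normed volume t * L) univ_mem
    (Eventually.of_forall fun y => (hcont y).aestronglyMeasurable)
    ((hcont x).integrable_of_hasCompactSupport ρ.hasCompactSupport_normed.mul_right)
    ?_ ?_ (ρ.integrable_normed.mul_const _) ?_).2.deriv
  · exact (ρ.continuous_normed.measurable.mul
      ((measurable_deriv φ).comp (measurable_const.sub measurable_id))).aestronglyMeasurable
  · refine Eventually.of_forall fun t => LipschitzWith.lipschitzOnWith ?_
    refine LipschitzWith.of_dist_le_mul fun y z => ?_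
    have h0 := ρ.nonneg_normed (μ := volume) t
    have h1 := hφ.dist_le_mul (y - t) (z - t)
    rw [dist_sub_right] at h1
    rw [coe_nnabs, abs_of_nonneg (by positivity), Real.dist_eq, ← mul_sub, abs_mul,
      abs_of_nonneg h0, mul_assoc]
    exact mul_le_mul_of_nonneg_left h1 h0
  · filter_upwards [(quasiMeasurePreserving_sub_left volume x).ae hφ.ae_differentiableAt_real]
      with t ht
    have h1 : HasDerivAt (fun y => φ (y - t)) (deriv φ (x - t)) x :=
      ht.hasDerivAt.comp_sub_const x t
    exact h1.const_mul _

theorem abs_deriv_mollify_le (ρ : ContDiffBump (0 : ℝ)) {φ : ℝ → ℝ} {L : ℝ≥0}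
    (hφ : LipschitzWith L φ) (x : ℝ) : |deriv (mollify ρ φ) x| ≤ L := by
  rw [deriv_mollify ρ hφ, mollify_apply, ← Real.norm_eq_abs]
  calc ‖∫ t, ρ.normed volume t * deriv φ (x - t)‖
      ≤ ∫ t, ρ.normed volume t * L := by
        refine norm_integral_le_of_norm_le (ρ.integrable_normed.mul_const _)
          (Eventually.of_forall fun t => ?_)
        rw [norm_mul, norm_of_nonneg (ρ.nonneg_normed (μ := volume) t)]
        exact mul_le_mul_of_nonneg_left (norm_deriv_le_of_lipschitz hφ)
          (ρ.nonneg_normed t)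
    _ = L := by rw [integral_mul_const, ContDiffBump.integral_normed, one_mul]

theorem abs_mollify_sub_le (ρ : ContDiffBump (0 : ℝ)) {φ : ℝ → ℝ} {L : ℝ≥0}
    (hφ : LipschitzWith L φ) (x : ℝ) : |mollify ρ φ x - φ x| ≤ L * ρ.rOut := by
  refine ContDiffBump.dist_normed_convolution_le hφ.continuous.aestronglyMeasurable
    fun y hy => (hφ.dist_le_mul y x).trans ?_
  exact mul_le_mul_of_nonneg_left (Metric.mem_ball.1 hy).le L.2

theorem Function.Periodic.deriv_periodic {f : ℝ → ℝ} {T : ℝ} (hf : Function.Periodic f T) :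
    Function.Periodic (deriv f) T := by
  intro x
  rw [← deriv_comp_add_const, funext hf]

theorem LipschitzWith.intervalIntegrable_deriv_mul_deriv {f g : ℝ → ℝ} {K L : ℝ≥0}
    (hf : LipschitzWith K f) (hg : LipschitzWith L g) (a b : ℝ) :
    IntervalIntegrable (fun x => deriv f x * deriv g x) volume a b := by
  refine (intervalIntegrable_const (c := (K * L : ℝ))).mono_fun
    ((measurable_deriv f).mul (measurable_deriv g)).aestronglyMeasurable
    (Eventually.of_forall fun x => ?_)
  simp only [norm_of_nonneg (by positivity : (0 : ℝ) ≤ K * L), norm_mul]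
  exact mul_le_mul (norm_deriv_le_of_lipschitz hf) (norm_deriv_le_of_lipschitz hg)
    (norm_nonneg _) K.2

/-- Integration by parts over a period. -/
theorem integral_mul_deriv_deriv_of_periodic {f ψ : ℝ → ℝ} {L : ℝ≥0} {T : ℝ}
    (hf : LipschitzWith L f) (hfT : Function.Periodic f T)
    (hψ : ContDiff ℝ (⊤ : ℕ∞) ψ) (hψT : Function.Periodic ψ T) :
    ∫ x in (0 : ℝ)..T, f x * deriv (deriv ψ) x = -∫ x in (0 : ℝ)..T, deriv f x * deriv ψ x := by
  have hd : ContDiff ℝ 1 (deriv ψ) :=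
    (contDiff_infty_iff_deriv.1 hψ).2.of_le (by exact_mod_cast le_top)
  have h1 := AbsolutelyContinuousOnInterval.integral_mul_deriv_eq_deriv_mul (a := 0) (b := T)
    hf.lipschitzOnWith.absolutelyContinuousOnInterval
    hd.contDiffOn.absolutelyContinuousOnInterval
  have h2 := hfT 0
  have h3 := hψT.deriv_periodic 0
  rw [zero_add] at h2 h3
  rw [h1, h2, h3, sub_self, zero_sub]

/-- The inequality `h'' + h ≥ 0` may be tested, in its weak form, against nonnegative periodic
Lipschitz functions. -/
theorem DistribConvexCirc.integral_deriv_mul_deriv_le {f φ : ℝ → ℝ} {K L : ℝ≥0}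
    (hf : DistribConvexCirc f) (hfL : LipschitzWith K f) (hfT : Function.Periodic f (2 * π))
    (hφL : LipschitzWith L φ) (hφT : Function.Periodic φ (2 * π)) (hφ : ∀ x, 0 ≤ φ x) :
    ∫ x in (0 : ℝ)..(2 * π), deriv f x * deriv φ x ≤ ∫ x in (0 : ℝ)..(2 * π), f x * φ x := by
  let ρ : ℕ → ContDiffBump (0 : ℝ) := fun i =>
    ⟨1 / (i + 1) / 2, 1 / (i + 1), by positivity, half_lt_self (by positivity)⟩
  have hρ : Tendsto (fun i => (ρ i).rOut) atTop (𝓝 0) :=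
    tendsto_one_div_add_atTop_nhds_zero_nat
  have hρ1 : ∀ i, (ρ i).rOut ≤ 1 := fun i =>
    (div_le_one (by positivity)).2 (le_add_of_nonneg_left i.cast_nonneg)
  have key : ∀ i, ∫ x in (0 : ℝ)..(2 * π), deriv f x * deriv (mollify (ρ i) φ) x ≤
      ∫ x in (0 : ℝ)..(2 * π), f x * mollify (ρ i) φ x := by
    intro i
    have hs := contDiff_mollify (ρ i) hφL.continuous
    have hT := periodic_mollify (ρ i) hφT
    have h1 := hf _ hs hT (mollify_nonneg (ρ i) hφ)
    have hs2 : Continuous (deriv (deriv (mollify (ρ i) φ))) :=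
      (contDiff_infty_iff_deriv.1 (contDiff_infty_iff_deriv.1 hs).2).2.continuous
    simp only [mul_add] at h1
    rw [intervalIntegral.integral_add ((hfL.continuous.fun_mul hs2).intervalIntegrable _ _)
      ((hfL.continuous.fun_mul hs.continuous).intervalIntegrable _ _),
      integral_mul_deriv_deriv_of_periodic hfL hfT hs hT] at h1
    linarith
  refine le_of_tendsto_of_tendsto' (b := atTop) ?_ ?_ key
  · refine intervalIntegral.tendsto_integral_filter_of_dominated_convergence
      (fun _ => (K * L : ℝ))
      (Eventually.of_forall fun i =>
        ((measurable_deriv f).mul (measurable_deriv _)).aestronglyMeasurable)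
      (Eventually.of_forall fun i => Eventually.of_forall fun x _ => ?_)
      intervalIntegrable_const ?_
    · rw [norm_mul]
      exact mul_le_mul (norm_deriv_le_of_lipschitz hfL) (abs_deriv_mollify_le (ρ i) hφL x)
        (norm_nonneg _) K.2
    · have hloc : LocallyIntegrable (deriv φ) volume :=
        (locallyIntegrable_const (L : ℝ)).mono (measurable_deriv φ).aestronglyMeasurable
          (Eventually.of_forall fun x => by
            simpa using norm_deriv_le_of_lipschitz (x₀ := x) hφL)
      filter_upwards [ContDiffBump.ae_convolution_tendsto_right_of_locallyIntegrable (φ := ρ)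
        (K := 2) hρ (Eventually.of_forall fun i => (mul_div_cancel₀ _ two_ne_zero).ge) hloc]
        with x hx _
      simp only [deriv_mollify _ hφL]
      exact hx.const_mul _
  · refine intervalIntegral.tendsto_integral_filter_of_dominated_convergence
      (fun x => |f x| * (|φ x| + L))
      (Eventually.of_forall fun i =>
        (hfL.continuous.mul
          (contDiff_mollify (ρ i) hφL.continuous).continuous).aestronglyMeasurable)
      (Eventually.of_forall fun i => Eventually.of_forall fun x _ => ?_)
      ((hfL.continuous.abs.mul (hφL.continuous.abs.add continuous_const)).intervalIntegrable _ _)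
      (Eventually.of_forall fun x _ =>
        (ContDiffBump.convolution_tendsto_right_of_continuous hρ hφL.continuous x).const_mul _)
    rw [norm_mul]
    refine mul_le_mul_of_nonneg_left ?_ (norm_nonneg _)
    have h1 := (abs_mollify_sub_le (ρ i) hφL x).trans
      (mul_le_of_le_one_right L.2 (hρ1 i))
    have h2 := abs_sub_abs_le_abs_sub (mollify (ρ i) φ x) (φ x)
    rw [Real.norm_eq_abs]
    linarith

/-- The `H¹` distance of two support functions is controlled by their uniform distance. -/
theorem DistribConvexCirc.integral_sq_add_sq_deriv_le {f g : ℝ → ℝ} {K L : ℝ≥0} {M ε : ℝ}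
    (hf : DistribConvexCirc f) (hfL : LipschitzWith K f) (hfT : Function.Periodic f (2 * π))
    (hg : DistribConvexCirc g) (hgL : LipschitzWith L g) (hgT : Function.Periodic g (2 * π))
    (hM : ∀ x, |g x| ≤ M) (hε : ∀ x, |f x - g x| ≤ ε) :
    ∫ x in (0 : ℝ)..(2 * π), ((f x - g x) ^ 2 + (deriv f x - deriv g x) ^ 2) ≤
      2 * π * (2 * ε * M + 3 * ε ^ 2) := by
  have hu : LipschitzWith (K + L) fun x => f x - g x := hfL.sub hgL
  have hp : LipschitzWith (0 + (K + L)) fun x => ε + (f x - g x) :=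
    (LipschitzWith.const ε).add hu
  have hm : LipschitzWith (0 + (K + L)) fun x => ε - (f x - g x) :=
    (LipschitzWith.const ε).sub hu
  have h1 := hf.integral_deriv_mul_deriv_le hfL hfT hp
    (fun x => by simp only [hfT x, hgT x]) (fun x => by linarith [neg_le_of_abs_le (hε x)])
  have h2 := hg.integral_deriv_mul_deriv_le hgL hgT hm
    (fun x => by simp only [hfT x, hgT x]) (fun x => by linarith [le_of_abs_le (hε x)])
  have i1 := (hfL.continuous.fun_mul hp.continuous).intervalIntegrable (μ := volume) 0 (2 * π)
  have i2 := (hgL.continuous.fun_mul hm.continuous).intervalIntegrable (μ := volume) 0 (2 * π)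
  have i3 := ((hu.continuous.fun_pow 2).intervalIntegrable (μ := volume) 0 (2 * π))
  have d1 := hfL.intervalIntegrable_deriv_mul_deriv hp 0 (2 * π)
  have d2 := hgL.intervalIntegrable_deriv_mul_deriv hm 0 (2 * π)
  have hsq : ∀ᵐ x, (f x - g x) ^ 2 + (deriv f x - deriv g x) ^ 2 =
      (f x - g x) ^ 2 + (deriv f x * deriv (fun x => ε + (f x - g x)) x +
        deriv g x * deriv (fun x => ε - (f x - g x)) x) := by
    filter_upwards [hfL.ae_differentiableAt_real, hgL.ae_differentiableAt_real] with x hx hy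
    rw [deriv_const_add, deriv_const_sub, deriv_fun_sub hx hy]
    ring
  have hpt : ∀ x, (f x - g x) ^ 2 + (f x * (ε + (f x - g x)) + g x * (ε - (f x - g x))) ≤
      2 * ε * M + 3 * ε ^ 2 := by
    intro x
    have h0 : 0 ≤ ε := (abs_nonneg _).trans (hε x)
    have a1 : (f x - g x) ^ 2 ≤ ε ^ 2 := sq_le_sq' (neg_le_of_abs_le (hε x)) (le_of_abs_le (hε x))
    have a2 : ε * g x ≤ ε * M := mul_le_mul_of_nonneg_left (le_of_abs_le (hM x)) h0
    have a3 : ε * (f x - g x) ≤ ε * ε := mul_le_mul_of_nonneg_left (le_of_abs_le (hε x)) h0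
    linarith
  calc ∫ x in (0 : ℝ)..(2 * π), ((f x - g x) ^ 2 + (deriv f x - deriv g x) ^ 2)
      = (∫ x in (0 : ℝ)..(2 * π), (f x - g x) ^ 2) +
        ((∫ x in (0 : ℝ)..(2 * π), deriv f x * deriv (fun x => ε + (f x - g x)) x) +
        ∫ x in (0 : ℝ)..(2 * π), deriv g x * deriv (fun x => ε - (f x - g x)) x) := by
        rw [← intervalIntegral.integral_add d1 d2, ← intervalIntegral.integral_add i3 (d1.add d2)]
        exact intervalIntegral.integral_congr_ae (hsq.mono fun x hx _ => hx)
    _ ≤ (∫ x in (0 : ℝ)..(2 * π), (f x - g x) ^ 2) +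
        ((∫ x in (0 : ℝ)..(2 * π), f x * (ε + (f x - g x))) +
        ∫ x in (0 : ℝ)..(2 * π), g x * (ε - (f x - g x))) := by gcongr
    _ = ∫ x in (0 : ℝ)..(2 * π),
        ((f x - g x) ^ 2 + (f x * (ε + (f x - g x)) + g x * (ε - (f x - g x)))) := by
        rw [← intervalIntegral.integral_add i1 i2, ← intervalIntegral.integral_add i3 (i1.add i2)]
    _ ≤ ∫ _ in (0 : ℝ)..(2 * π), (2 * ε * M + 3 * ε ^ 2) :=
        intervalIntegral.integral_mono_on two_pi_pos.le (i3.add (i1.add i2))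
          intervalIntegrable_const fun x _ => hpt x
    _ = 2 * π * (2 * ε * M + 3 * ε ^ 2) := by
        rw [intervalIntegral.integral_const, sub_zero, smul_eq_mul]

/-- If a sequence of support functions of planar convex bodies (i.e. `2π`-periodic
Lipschitz functions with `h'' + h ≥ 0` distributionally) converges uniformly, then it
converges in the `H¹` sense: Hausdorff convergence of convex bodies implies `H¹`
convergence of the support functions. -/
theorem uniform_convergence_implies_H1_convergence
    (h : ℕ → ℝ → ℝ) (hinf : ℝ → ℝ)
    (hper : ∀ n, Function.Periodic (h n) (2 * π)) (hperi : Function.Periodic hinf (2 * π))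
    (hlip : ∀ n, ∃ L, LipschitzWith L (h n)) (hlipi : ∃ L, LipschitzWith L hinf)
    (hconv : ∀ n, DistribConvexCirc (h n)) (hconvi : DistribConvexCirc hinf)
    (hunif : TendstoUniformly h hinf atTop) :
    Tendsto (fun n => ∫ θ in (0:ℝ)..(2 * π),
        ((h n θ - hinf θ) ^ 2 + (deriv (h n) θ - deriv hinf θ) ^ 2))
      atTop (nhds 0) := by
  obtain ⟨L, hL⟩ := hlipi
  obtain ⟨M, hM⟩ : ∃ M, ∀ x, |hinf x| ≤ M := by
    obtain ⟨M, hM⟩ := (hperi.isBounded_of_continuous two_pi_pos.ne' hL.continuous).exists_norm_le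
    exact ⟨M, fun x => hM _ (mem_range_self x)⟩
  have hbound : Tendsto (fun ε : ℝ => 2 * π * (2 * ε * M + 3 * ε ^ 2)) (𝓝 0) (𝓝 0) := by
    have hc : Continuous fun ε : ℝ => 2 * π * (2 * ε * M + 3 * ε ^ 2) := by fun_prop
    simpa using hc.tendsto 0
  refine tendsto_order.2 ⟨fun a ha => Eventually.of_forall fun n => ha.trans_le ?_, fun a ha => ?_⟩
  · exact intervalIntegral.integral_nonneg two_pi_pos.le fun x _ => by positivity
  · obtain ⟨ε, hεa, hε⟩ := (((hbound.eventually_lt_const ha).filter_mono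
      nhdsWithin_le_nhds).and (self_mem_nhdsWithin (s := Ioi 0))).exists
    filter_upwards [Metric.tendstoUniformly_iff.1 hunif ε hε] with n hn
    obtain ⟨K, hK⟩ := hlip n
    refine ((hconv n).integral_sq_add_sq_deriv_le hK (hper n) hconvi hL hperi hM
      fun x => ?_).trans_lt hεa
    rw [← Real.dist_eq, dist_comm]
    exact (hn x).le
end
end
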